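/- Fix a role name r ∈ N_R. There is a constant k (independent of n) such that for every n ≥ 1 there exists a satisfiable ALCι concept C_n whose syntax tree has at most k·n² nodes, with the property that every interpretation I with C_n^I ≠ ∅ contains pairwise distinct elements d_0, d_1, …, d_{2^n−1} ∈ Δ^I such that (d_i, d_{i+1}) ∈ r^I for every i < 2^n − 1; that is, every model of C_n contains an r-path of length exponential in the size of C_n. -/

import Mathlib

universe u v

namespace DL

/-- ALCι concepts, with atomic concept names and role names both drawn from
the countably infinite (and disjoint, being distinct sorts) sets `ℕ`. -/
inductive Concept : Type
  | atom : ℕ → Concept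
  | neg : Concept → Concept
  | conj : Concept → Concept → Concept
  | ex : ℕ → Concept → Concept
  | iotaL : Concept → Concept
  | iotaG : Concept → Concept → Concept
  deriving DecidableEq

/-- An interpretation with (nonempty) domain `D`. -/
structure Interp (D : Type u) where
  atomI : ℕ → Set D
  roleI : ℕ → Set (D × D)

/-- The extension `C^I` of a concept `C` in the interpretation `I`. -/
def Interp.sem {D : Type u} (I : Interp D) : Concept → Set D
  | .atom A => I.atomI A
  | .neg C => (I.sem C)ᶜ
  | .conj C D' => I.sem C ∩ I.sem D'
  | .ex r C => {d | ∃ e, (d, e) ∈ I.roleI r ∧ e ∈ I.sem C}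
  | .iotaL C => {d | I.sem C = {d}}
  | .iotaG C D' => {_d | ∃ e, I.sem C = {e} ∧ e ∈ I.sem D'}

/-- Concepts not using the global definite description constructor `ιC.D`,
i.e. ALCι_L concepts. -/
def Concept.noG : Concept → Prop
  | .atom _ => True
  | .neg C => C.noG
  | .conj C D => C.noG ∧ D.noG
  | .ex _ C => C.noG
  | .iotaL C => C.noG
  | .iotaG _ _ => False

/-- Concepts not using the local definite description constructor `{ιC}`,
i.e. ALCι_G concepts. -/
def Concept.noL : Concept → Prop
  | .atom _ => True
  | .neg C => C.noL
  | .conj C D => C.noL ∧ D.noL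
  | .ex _ C => C.noL
  | .iotaL _ => False
  | .iotaG C D => C.noL ∧ D.noL

/-- ALC concepts: neither local nor global definite descriptions. -/
def Concept.isALC (C : Concept) : Prop := C.noG ∧ C.noL

/-- The size of a concept: the number of nodes of its syntax tree. -/
def nodes : Concept → ℕ
  | .atom _ => 1
  | .neg C => nodes C + 1
  | .conj C D => nodes C + nodes D + 1
  | .ex _ C => nodes C + 1
  | .iotaL C => nodes C + 1
  | .iotaG C D => nodes C + nodes D + 1

/-- The concept `⊤`. -/
def Concept.top : Concept := .neg (.conj (.atom 0) (.neg (.atom 0)))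

/-- The conjunction of `f 0, …, f (n - 1)`. -/
def Concept.bigConj (f : ℕ → Concept) : ℕ → Concept
  | 0 => .top
  | n + 1 => .conj (bigConj f n) (f n)

/-- The implication `C → D`. -/
def Concept.imp (C D : Concept) : Concept := .neg (.conj C (.neg D))

section Semantics

variable {D : Type u} (I : Interp D)

theorem Interp.mem_sem_neg {C : Concept} {x : D} : x ∈ I.sem (.neg C) ↔ x ∉ I.sem C :=
  Iff.rfl

theorem Interp.mem_sem_conj {C C' : Concept} {x : D} :
    x ∈ I.sem (.conj C C') ↔ x ∈ I.sem C ∧ x ∈ I.sem C' :=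
  Iff.rfl

theorem Interp.mem_sem_ex {s : ℕ} {C : Concept} {x : D} :
    x ∈ I.sem (.ex s C) ↔ ∃ y, (x, y) ∈ I.roleI s ∧ y ∈ I.sem C :=
  Iff.rfl

theorem Interp.mem_sem_atom {a : ℕ} {x : D} : x ∈ I.sem (.atom a) ↔ x ∈ I.atomI a :=
  Iff.rfl

theorem Interp.mem_sem_top {x : D} : x ∈ I.sem .top := by
  simp [Concept.top, Interp.sem]

theorem Interp.mem_sem_bigConj {f : ℕ → Concept} {n : ℕ} {x : D} :
    x ∈ I.sem (.bigConj f n) ↔ ∀ k < n, x ∈ I.sem (f k) := by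
  induction n with
  | zero => simpa [Concept.bigConj] using I.mem_sem_top
  | succ n ih =>
    rw [Concept.bigConj, I.mem_sem_conj, ih, Nat.forall_lt_succ_right]

theorem Interp.mem_sem_imp {C C' : Concept} {x : D} :
    x ∈ I.sem (.imp C C') ↔ (x ∈ I.sem C → x ∈ I.sem C') := by
  simp only [Concept.imp, mem_sem_neg, mem_sem_conj]
  tauto

end Semantics

theorem nodes_top : nodes .top = 5 := rfl

theorem nodes_bigConj_le {f : ℕ → Concept} {c : ℕ} (h : ∀ k, nodes (f k) ≤ c) (n : ℕ) :
    nodes (.bigConj f n) ≤ (c + 1) * n + 5 := by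
  induction n with
  | zero => simp [Concept.bigConj, nodes_top]
  | succ n ih =>
    have := h n
    simp only [Concept.bigConj, nodes]
    linarith

namespace Counter

/-- The bits below `j` are set and bit `j` is not. -/
def firstZero (j k : ℕ) : Concept :=
  if k < j then .atom k else if k = j then .neg (.atom k) else .top

/-- The bits below `j` are cleared and bit `j` is set. -/
def flipped (j k : ℕ) : Concept :=
  if k < j then .neg (.atom k) else if k = j then .atom k else .top

/-- The bits above `j` are preserved by all `r`-successors. -/
def kept (r j k : ℕ) : Concept :=
  if k ≤ j then .top else
    .conj (.neg (.conj (.atom k) (.ex r (.neg (.atom k)))))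
      (.neg (.conj (.neg (.atom k)) (.ex r (.atom k))))

/-- If `j` is the least unset bit, some `r`-successor carries the incremented counter. -/
def incrementAt (r n j : ℕ) : Concept :=
  .imp (.bigConj (firstZero j) n)
    (.conj (.ex r (.bigConj (flipped j) n)) (.bigConj (kept r j) n))

/-- The counter is incremented along `r`. -/
def increment (r n : ℕ) : Concept := .bigConj (incrementAt r n) n

/-- The counter is zero. -/
def isZero (n : ℕ) : Concept := .bigConj (fun k => .neg (.atom k)) n

/-- `increment r n` holds everywhere, and the atom `n` names a single element,
whose counter is zero. -/
def counter (r n : ℕ) : Concept :=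
  .iotaG (.imp (increment r n) (.atom n))
    (.conj (.atom n) (.conj (increment r n) (isZero n)))

theorem nodes_incrementAt_le (r n j : ℕ) : nodes (incrementAt r n j) ≤ 26 * n + 20 := by
  have h₁ := nodes_bigConj_le (f := firstZero j) (c := 5)
    (fun k => by unfold firstZero; split_ifs <;> simp [nodes, nodes_top]) n
  have h₂ := nodes_bigConj_le (f := flipped j) (c := 5)
    (fun k => by unfold flipped; split_ifs <;> simp [nodes, nodes_top]) n
  have h₃ := nodes_bigConj_le (f := kept r j) (c := 13)
    (fun k => by unfold kept; split_ifs <;> simp [nodes, nodes_top]) n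
  simp only [incrementAt, Concept.imp, nodes]
  omega

theorem nodes_counter_le (r : ℕ) {n : ℕ} (hn : 1 ≤ n) : nodes (counter r n) ≤ 200 * n ^ 2 := by
  have h₁ := nodes_bigConj_le (nodes_incrementAt_le r n) n
  have h₂ := nodes_bigConj_le (f := fun k => .neg (.atom k)) (c := 2)
    (fun k => by simp [nodes]) n
  simp only [counter, increment, isZero, Concept.imp, nodes]
  nlinarith

theorem testBit_succ_of_firstZero {i j : ℕ} (h : ∀ k < j, i.testBit k = true)
    (hj : i.testBit j = false) (k : ℕ) :
    (i + 1).testBit k = if k < j then false else if k = j then true else i.testBit k := by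
  induction j generalizing i k with
  | zero =>
    have h0 : i % 2 = 0 := by simpa [Nat.testBit_zero] using hj
    cases k with
    | zero => simp [Nat.testBit_zero]; omega
    | succ k =>
      have : (i + 1) / 2 = i / 2 := by omega
      simp [Nat.testBit_succ, this]
  | succ j ih =>
    have h0 : i % 2 = 1 := by simpa [Nat.testBit_zero] using h 0 (by omega)
    have hd : (i + 1) / 2 = i / 2 + 1 := by omega
    cases k with
    | zero => simp [Nat.testBit_zero]; omega
    | succ k =>
      have := ih (i := i / 2) (fun k hk => by
        rw [← Nat.testBit_succ]; exact h (k + 1) (by omega))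
        (by rw [← Nat.testBit_succ]; exact hj) k
      rw [Nat.testBit_succ, hd, this, Nat.testBit_succ]
      simp

theorem exists_firstZero {i n : ℕ} (hi : i + 1 < 2 ^ n) :
    ∃ j < n, (∀ k < j, i.testBit k = true) ∧ i.testBit j = false := by
  classical
  have h : ∃ j, i.testBit j = false := ⟨n, Nat.testBit_lt_two_pow (by omega)⟩
  have hmin : ∀ k < Nat.find h, i.testBit k = true := fun k hk => by
    simpa using Nat.find_min h hk
  refine ⟨Nat.find h, ?_, hmin, Nat.find_spec h⟩
  by_contra! hn
  have : i = 2 ^ n - 1 := Nat.eq_of_testBit_eq fun k => by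
    rw [Nat.testBit_two_pow_sub_one]
    by_cases hk : k < n
    · simp [hk, hmin k (by omega)]
    · simp only [hk, decide_false]
      exact Nat.testBit_lt_two_pow (lt_of_lt_of_le (by omega : i < 2 ^ n)
        (Nat.pow_le_pow_right (by omega) (by omega)))
  omega

section Models

variable {D : Type u} (I : Interp D)

/-- The first `n` atoms hold at `x` exactly as the first `n` bits of `i` prescribe. -/
def HasValue (n : ℕ) (x : D) (i : ℕ) : Prop :=
  ∀ k < n, x ∈ I.atomI k ↔ i.testBit k = true

variable {I}

theorem HasValue.eq {n : ℕ} {x : D} {i j : ℕ} (hxi : HasValue I n x i) (hxj : HasValue I n x j)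
    (hi : i < 2 ^ n) (hj : j < 2 ^ n) : i = j :=
  Nat.eq_of_testBit_eq fun k => by
    by_cases hk : k < n
    · rw [Bool.eq_iff_iff, ← hxi k hk, ← hxj k hk]
    · have hp : 2 ^ n ≤ 2 ^ k := Nat.pow_le_pow_right (by omega) (by omega)
      rw [Nat.testBit_lt_two_pow (hi.trans_le hp), Nat.testBit_lt_two_pow (hj.trans_le hp)]

theorem HasValue.exists_succ {r n : ℕ} {x : D} {i : ℕ} (hx : HasValue I n x i)
    (hinc : x ∈ I.sem (increment r n)) (hi : i + 1 < 2 ^ n) :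
    ∃ y, (x, y) ∈ I.roleI r ∧ HasValue I n y (i + 1) := by
  obtain ⟨j, hjn, hlow, hj⟩ := exists_firstZero hi
  have hstep := I.mem_sem_bigConj.1 hinc j hjn
  rw [incrementAt, I.mem_sem_imp, I.mem_sem_conj, I.mem_sem_ex, I.mem_sem_bigConj] at hstep
  obtain ⟨⟨y, hxy, hy⟩, hkeep⟩ := hstep fun k hk => by
    unfold firstZero
    split_ifs with h₁ h₂
    · exact (hx k hk).2 (hlow k h₁)
    · subst h₂
      rw [I.mem_sem_neg, I.mem_sem_atom, hx k hk, hj]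
      simp
    · exact I.mem_sem_top
  refine ⟨y, hxy, fun k hk => ?_⟩
  rw [I.mem_sem_bigConj] at hy hkeep
  have hyk := hy k hk
  have hkk := hkeep k hk
  rw [testBit_succ_of_firstZero hlow hj]
  unfold flipped at hyk
  unfold kept at hkk
  rcases lt_trichotomy k j with h | h | h
  · simpa [h, Interp.sem] using hyk
  · simpa [h, Interp.sem] using hyk
  · rw [if_neg (by omega)] at hkk
    simp only [Interp.mem_sem_conj, Interp.mem_sem_neg, Interp.mem_sem_ex,
      Interp.mem_sem_atom] at hkk
    rw [if_neg (by omega), if_neg (by omega), ← hx k hk]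
    by_cases hxk : x ∈ I.atomI k
    · simp only [hxk, iff_true]
      by_contra hyk'
      exact hkk.1 ⟨hxk, y, hxy, hyk'⟩
    · simp only [hxk, iff_false]
      exact fun hyk' => hkk.2 ⟨hxk, y, hxy, hyk'⟩

theorem exists_path {r n : ℕ} (h : (I.sem (counter r n)).Nonempty) :
    ∃ d : ℕ → D,
      (∀ i j : ℕ, i < 2 ^ n → j < 2 ^ n → i ≠ j → d i ≠ d j) ∧
      (∀ i : ℕ, i + 1 < 2 ^ n → (d i, d (i + 1)) ∈ I.roleI r) := by
  obtain ⟨_, e, he, -, heinc, hezero⟩ := h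
  have hinc : ∀ x, x ∈ I.sem (increment r n) := fun x => by
    by_contra hx
    have hxe : x ∈ I.sem (.imp (increment r n) (.atom n)) :=
      I.mem_sem_imp.2 fun h => absurd h hx
    rw [he] at hxe
    exact hx (hxe ▸ heinc)
  have hex : ∀ (i : ℕ) (x : D), ∃ y, HasValue I n x i → i + 1 < 2 ^ n →
      (x, y) ∈ I.roleI r ∧ HasValue I n y (i + 1) := fun i x => by
    by_cases hx : HasValue I n x i ∧ i + 1 < 2 ^ n
    · obtain ⟨y, hy⟩ := hx.1.exists_succ (hinc x) hx.2
      exact ⟨y, fun _ _ => hy⟩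
    · exact ⟨x, fun h₁ h₂ => absurd ⟨h₁, h₂⟩ hx⟩
  choose f hf using hex
  let d : ℕ → D := fun i => Nat.rec e f i
  have hd : ∀ i, i < 2 ^ n → HasValue I n (d i) i := fun i => by
    induction i with
    | zero =>
      intro _ k hk
      have := I.mem_sem_bigConj.1 hezero k hk
      simpa [Interp.sem, d] using this
    | succ i ih => exact fun hi => (hf i (d i) (ih (by omega)) hi).2
  refine ⟨d, fun i j hi hj hij hdij => hij ?_, fun i hi => (hf i (d i) (hd i (by omega)) hi).1⟩
  exact (hd i hi).eq (hdij ▸ hd j hj) hi hj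

end Models

/-- The natural numbers with successor as every role, bits as the first `n` atoms and
`{0}` as the remaining ones. -/
def natModel (n : ℕ) : Interp (ULift.{u} ℕ) where
  atomI k := {x | if k < n then x.down.testBit k = true else x.down = 0}
  roleI _ := {p | p.2.down = p.1.down + 1}

theorem mem_increment_natModel (r n : ℕ) (x : ULift.{u} ℕ) :
    x ∈ (natModel n).sem (increment r n) := by
  refine (Interp.mem_sem_bigConj _).2 fun j hj => (Interp.mem_sem_imp _).2 fun hpre => ?_
  rw [Interp.mem_sem_bigConj] at hpre
  have hlow : ∀ k < j, x.down.testBit k = true := fun k hk => by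
    have hkn : k < n := hk.trans hj
    simpa [firstZero, hk, Interp.sem, natModel, hkn] using hpre k hkn
  have hzero : x.down.testBit j = false := by
    simpa [firstZero, Interp.sem, natModel, hj] using hpre j hj
  have hbits := testBit_succ_of_firstZero hlow hzero
  rw [Interp.mem_sem_conj, Interp.mem_sem_ex, Interp.mem_sem_bigConj]
  refine ⟨⟨⟨x.down + 1⟩, rfl, (Interp.mem_sem_bigConj _).2 fun k hk => ?_⟩, fun k hk => ?_⟩
  · unfold flipped
    split_ifs with h₁ h₂
    · simp [Interp.sem, natModel, hk, hbits, h₁]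
    · simp [Interp.sem, natModel, hbits, h₂, hj]
    · exact Interp.mem_sem_top _
  · unfold kept
    split_ifs with h₁
    · exact Interp.mem_sem_top _
    · have h₂ : ¬ k < j := by omega
      have h₃ : k ≠ j := by omega
      simp only [Interp.mem_sem_conj, Interp.mem_sem_neg, Interp.mem_sem_ex,
        Interp.mem_sem_atom, natModel, Set.mem_ofPred_eq, hk, if_true]
      constructor
      · rintro ⟨hx, y, hy, hyk⟩
        rw [hy, hbits, if_neg h₂, if_neg h₃] at hyk
        exact hyk hx
      · rintro ⟨hx, y, hy, hyk⟩
        rw [hy, hbits, if_neg h₂, if_neg h₃] at hyk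
        exact hx hyk

theorem sem_counter_natModel_nonempty (r n : ℕ) :
    ((natModel.{u} n).sem (counter r n)).Nonempty := by
  refine ⟨⟨0⟩, ⟨0⟩, ?_, ?_, mem_increment_natModel r n _,
    (Interp.mem_sem_bigConj _).2 fun k hk => ?_⟩
  · ext x
    rw [Interp.mem_sem_imp, imp_iff_right (mem_increment_natModel r n x)]
    simp [Interp.sem, natModel, ULift.ext_iff]
  · simp [Interp.sem, natModel]
  · simp [Interp.sem, natModel, hk]

end Counter

/-- there is a constant `k` such that for every `n ≥ 1` there is
a satisfiable ALCι concept `C_n` of size at most `k·n²` each of whose models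
contains an `r`-path through `2^n` pairwise distinct elements. -/
theorem stmt16 (r : ℕ) :
    ∃ k : ℕ, ∀ n : ℕ, 1 ≤ n →
      ∃ Cn : Concept,
        nodes Cn ≤ k * n ^ 2 ∧
        (∃ (D : Type u) (_ : Nonempty D) (I : Interp D), (I.sem Cn).Nonempty) ∧
        (∀ (D : Type u) [Nonempty D] (I : Interp D), (I.sem Cn).Nonempty →
          ∃ d : ℕ → D,
            (∀ i j : ℕ, i < 2 ^ n → j < 2 ^ n → i ≠ j → d i ≠ d j) ∧
            (∀ i : ℕ, i + 1 < 2 ^ n → (d i, d (i + 1)) ∈ I.roleI r)) := by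
  refine ⟨200, fun n hn => ⟨Counter.counter r n, Counter.nodes_counter_le r hn,
    ⟨ULift ℕ, ⟨⟨0⟩⟩, Counter.natModel n, Counter.sem_counter_natModel_nonempty r n⟩, ?_⟩⟩
  intro D _ I hI
  exact Counter.exists_path hI

end DL
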